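/- arXiv:2108.11285 — 4 statements merged into one kernel-verified Lean document; each statement's English description precedes it below -/
import Mathlib

section
/- The total number of Latin triangles of side length 5 (with no normalization of the bottom row) is exactly 480 = 4 · 5!. -/
/-- The index set of a Latin triangle of side length `n`:
pairs `(i,j)` of positive integers with `i + j ≤ n + 1`. -/
def TriIdx (n : ℕ) : Type :=
  {p : ℕ × ℕ // 1 ≤ p.1 ∧ 1 ≤ p.2 ∧ p.1 + p.2 ≤ n + 1}

/-- `M` is a Latin triangle of side length `n`: it assigns to each pair `(i,j)`
of positive integers with `i + j ≤ n + 1` a value in `{1,…,n}`, taking distinct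
values on each row (same `i`), each left diagonal (same `j`), and each right
diagonal (same `i + j`). -/
def IsLatinTriangle (n : ℕ) (M : TriIdx n → ℕ) : Prop :=
  (∀ p : TriIdx n, 1 ≤ M p ∧ M p ≤ n) ∧
  (∀ p q : TriIdx n, p.val.1 = q.val.1 → p ≠ q → M p ≠ M q) ∧
  (∀ p q : TriIdx n, p.val.2 = q.val.2 → p ≠ q → M p ≠ M q) ∧
  (∀ p q : TriIdx n, p.val.1 + p.val.2 = q.val.1 + q.val.2 → p ≠ q → M p ≠ M q)

/-- A Latin triangle is reduced if its bottom row is the identity: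
`M (1, j) = j` for all `j`. -/
def IsReducedLatinTriangle (n : ℕ) (M : TriIdx n → ℕ) : Prop :=
  ∀ p : TriIdx n, p.val.1 = 1 → M p = p.val.2

/-- Two cells on a common line. -/
def LTri.conf (p q : ℕ × ℕ) : Bool :=
  Nat.beq p.1 q.1 || (Nat.beq p.2 q.2 || Nat.beq (p.1 + p.2) (q.1 + q.2))

/-- The value `v` may be put in cell `p`, given the partial filling `l`. -/
def LTri.ok (p : ℕ × ℕ) (v : ℕ) (l : List ((ℕ × ℕ) × ℕ)) : Bool :=
  l.all fun x => !(LTri.conf p x.1 && Nat.beq v x.2)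

/-- All fillings of a list of cells, by backtracking. -/
def LTri.sols : List (ℕ × ℕ) → List (List ((ℕ × ℕ) × ℕ))
  | [] => [[]]
  | p :: ps => (LTri.sols ps).flatMap fun l =>
      (([1, 2, 3, 4, 5] : List ℕ).filter fun v => LTri.ok p v l).map fun v => (p, v) :: l

/-- The cells of the triangle of side 5. -/
def LTri.cells : List (ℕ × ℕ) :=
  [(5,1),(4,1),(4,2),(3,1),(3,2),(3,3),(2,1),(2,2),(2,3),(2,4),(1,1),(1,2),(1,3),(1,4),(1,5)]

theorem LTri.sols_length : (LTri.sols LTri.cells).length = 480 := by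
  decide +kernel

theorem LTri.conf_iff (p q : ℕ × ℕ) :
    LTri.conf p q = true ↔ p.1 = q.1 ∨ p.2 = q.2 ∨ p.1 + p.2 = q.1 + q.2 := by
  simp [LTri.conf]

theorem LTri.sols_nodup (ps : List (ℕ × ℕ)) : (LTri.sols ps).Nodup := by
  induction ps with
  | nil => simp [LTri.sols]
  | cons p ps ih =>
    rw [LTri.sols, List.nodup_flatMap]
    refine ⟨fun l _ => ?_, ?_⟩
    · refine List.Nodup.map ?_ (List.Nodup.filter _ (by decide))
      intro a b h
      simpa using h
    · refine List.Pairwise.imp ?_ ih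
      intro a b hab x hxa hxb
      simp only [List.mem_map] at hxa hxb
      obtain ⟨v, _, rfl⟩ := hxa
      obtain ⟨w, _, hw⟩ := hxb
      simp only [List.cons.injEq] at hw
      exact hab hw.2.symm

theorem LTri.mem_sols (M : ℕ × ℕ → ℕ) (ps : List (ℕ × ℕ)) :
    ps.map (fun p => (p, M p)) ∈ LTri.sols ps ↔
      (∀ p ∈ ps, 1 ≤ M p ∧ M p ≤ 5) ∧
        ps.Pairwise (fun p q => LTri.conf p q = true → M p ≠ M q) := by
  induction ps with
  | nil => simp [LTri.sols]
  | cons p ps ih =>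
    have h5 : ∀ v : ℕ, v ∈ ([1, 2, 3, 4, 5] : List ℕ) ↔ 1 ≤ v ∧ v ≤ 5 := by
      intro v
      simp only [List.mem_cons, List.not_mem_nil, or_false]
      omega
    have hok : LTri.ok p (M p) (ps.map (fun p => (p, M p))) = true ↔
        ∀ q ∈ ps, LTri.conf p q = true → M p ≠ M q := by
      simp only [LTri.ok, List.all_map, List.all_eq_true, Function.comp]
      refine forall₂_congr fun q _ => ?_
      have hb : Nat.beq (M p) (M q) = true ↔ M p = M q := ⟨Nat.eq_of_beq_eq_true, fun h => by simp [h]⟩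
      rw [Ne, ← hb]
      cases LTri.conf p q <;> cases Nat.beq (M p) (M q) <;> decide
    have hl : (p :: ps).map (fun p => (p, M p)) ∈ LTri.sols (p :: ps) ↔
        ps.map (fun p => (p, M p)) ∈ LTri.sols ps ∧ (1 ≤ M p ∧ M p ≤ 5) ∧
          LTri.ok p (M p) (ps.map (fun p => (p, M p))) = true := by
      rw [LTri.sols, List.mem_flatMap]
      constructor
      · rintro ⟨l, hl, h⟩
        rw [List.mem_map] at h
        obtain ⟨v, hv, h⟩ := h
        rw [List.map_cons, List.cons.injEq, Prod.mk.injEq] at h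
        obtain ⟨⟨_, rfl⟩, rfl⟩ := h
        rw [List.mem_filter, h5] at hv
        exact ⟨hl, hv.1, hv.2⟩
      · rintro ⟨h1, h2, h3⟩
        refine ⟨_, h1, ?_⟩
        rw [List.mem_map]
        exact ⟨M p, List.mem_filter.2 ⟨(h5 _).2 h2, h3⟩, rfl⟩
    rw [hl, ih, hok, List.pairwise_cons, List.forall_mem_cons]
    tauto

theorem LTri.exists_of_mem (ps : List (ℕ × ℕ)) (hps : ps.Nodup) :
    ∀ l ∈ LTri.sols ps, ∃ M : ℕ × ℕ → ℕ, ps.map (fun p => (p, M p)) = l := by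
  induction ps with
  | nil => intro l hl; exact ⟨fun _ => 0, by simpa [LTri.sols, eq_comm] using hl⟩
  | cons p ps ih =>
    intro l hl
    rw [List.nodup_cons] at hps
    rw [LTri.sols, List.mem_flatMap] at hl
    obtain ⟨m, hm, h⟩ := hl
    rw [List.mem_map] at h
    obtain ⟨v, _, rfl⟩ := h
    obtain ⟨M, rfl⟩ := ih hps.2 m hm
    refine ⟨Function.update M p v, ?_⟩
    rw [List.map_cons, Function.update_self]
    congr 1
    refine List.map_congr_left fun q hq => ?_
    rw [Function.update_of_ne]
    rintro rfl
    exact hps.1 hq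

theorem LTri.mem_cells (p : ℕ × ℕ) :
    p ∈ LTri.cells ↔ 1 ≤ p.1 ∧ 1 ≤ p.2 ∧ p.1 + p.2 ≤ 5 + 1 := by
  obtain ⟨i, j⟩ := p
  constructor
  · have h : ∀ p ∈ LTri.cells, 1 ≤ p.1 ∧ 1 ≤ p.2 ∧ p.1 + p.2 ≤ 5 + 1 := by decide
    exact h (i, j)
  · rintro ⟨h1, h2, h3⟩
    have h : ∀ i : Fin 6, ∀ j : Fin 6, 1 ≤ i.val → 1 ≤ j.val → i.val + j.val ≤ 6 →
        (i.val, j.val) ∈ LTri.cells := by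
      decide +kernel
    simp only at h1 h2 h3
    exact h ⟨i, by omega⟩ ⟨j, by omega⟩ h1 h2 h3

theorem LTri.cells_nodup : LTri.cells.Nodup := by decide

/-- Extension by zero. -/
def LTri.ext0 (M : TriIdx 5 → ℕ) (p : ℕ × ℕ) : ℕ :=
  if h : 1 ≤ p.1 ∧ 1 ≤ p.2 ∧ p.1 + p.2 ≤ 5 + 1 then M ⟨p, h⟩ else 0

theorem LTri.ext0_val (M : TriIdx 5 → ℕ) (p : TriIdx 5) : LTri.ext0 M p.val = M p := by
  unfold LTri.ext0
  rw [dif_pos p.2]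
  rfl

theorem LTri.latin_iff (M : TriIdx 5 → ℕ) :
    IsLatinTriangle 5 M ↔
      LTri.cells.map (fun p => (p, LTri.ext0 M p)) ∈ LTri.sols LTri.cells := by
  rw [LTri.mem_sols]
  have e := LTri.ext0_val M
  have cell : ∀ p ∈ LTri.cells, ∃ P : TriIdx 5, P.val = p :=
    fun p hp => ⟨⟨p, (LTri.mem_cells p).1 hp⟩, rfl⟩
  constructor
  · rintro ⟨h1, h2, h3, h4⟩
    constructor
    · intro p hp
      obtain ⟨P, rfl⟩ := cell p hp
      rw [e]
      exact h1 P
    · refine List.Pairwise.imp_of_mem ?_ LTri.cells_nodup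
      intro p q hp hq hpq hc
      obtain ⟨P, rfl⟩ := cell p hp
      obtain ⟨Q, rfl⟩ := cell q hq
      have hne : P ≠ Q := fun h => hpq (congrArg Subtype.val h)
      rw [e, e]
      rcases (LTri.conf_iff _ _).1 hc with h | h | h
      · exact h2 _ _ h hne
      · exact h3 _ _ h hne
      · exact h4 _ _ h hne
  · rintro ⟨h1, h2⟩
    have hs : ∀ p ∈ LTri.cells, ∀ q ∈ LTri.cells, p ≠ q →
        (LTri.conf p q = true → LTri.ext0 M p ≠ LTri.ext0 M q) := by
      intro p hp q hq hpq
      have : Std.Symm (fun p q : ℕ × ℕ =>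
          LTri.conf p q = true → LTri.ext0 M p ≠ LTri.ext0 M q) := by
        refine ⟨fun a b h hc => (h ?_).symm⟩
        rw [LTri.conf_iff] at hc ⊢
        omega
      exact List.Pairwise.forall h2 hp hq hpq
    have key : ∀ p q : TriIdx 5, (p.val.1 = q.val.1 ∨ p.val.2 = q.val.2 ∨
        p.val.1 + p.val.2 = q.val.1 + q.val.2) → p ≠ q → M p ≠ M q := by
      intro p q h hpq
      rw [← e, ← e]
      exact hs _ ((LTri.mem_cells _).2 p.2) _ ((LTri.mem_cells _).2 q.2)
        (fun h => hpq (Subtype.ext h)) ((LTri.conf_iff _ _).2 h)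
    refine ⟨fun p => ?_, fun p q h => key p q (Or.inl h),
      fun p q h => key p q (Or.inr (Or.inl h)), fun p q h => key p q (Or.inr (Or.inr h))⟩
    rw [← e]
    exact h1 _ ((LTri.mem_cells _).2 p.2)

/-- The total number of Latin triangles of side length 5
(with no normalization of the bottom row) is exactly 480 = 4·5!. -/
theorem latin_triangles_side_5 :
    Set.ncard {M : TriIdx 5 → ℕ | IsLatinTriangle 5 M} = 480 := by
  have hinj : Function.Injective
      (fun M : TriIdx 5 → ℕ => LTri.cells.map (fun p => (p, LTri.ext0 M p))) := by
    intro M N h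
    funext p
    have := List.map_inj_left.1 h p.val ((LTri.mem_cells _).2 p.2)
    rw [Prod.mk.injEq, LTri.ext0_val, LTri.ext0_val] at this
    exact this.2
  rw [← Set.ncard_image_of_injective _ hinj]
  have : Set.image (fun M : TriIdx 5 → ℕ => LTri.cells.map (fun p => (p, LTri.ext0 M p)))
      {M : TriIdx 5 → ℕ | IsLatinTriangle 5 M} = ((LTri.sols LTri.cells).toFinset : Set _) := by
    ext l
    simp only [Set.mem_image, Set.mem_ofPred_eq, Finset.mem_coe, List.mem_toFinset]
    constructor
    · rintro ⟨M, hM, rfl⟩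
      exact (LTri.latin_iff M).1 hM
    · intro hl
      obtain ⟨M, hM⟩ := LTri.exists_of_mem _ LTri.cells_nodup l hl
      have hE : LTri.cells.map (fun p => (p, LTri.ext0 (fun q => M q.val) p)) = l := by
        rw [← hM]
        refine List.map_congr_left fun p hp => ?_
        have := LTri.ext0_val (fun q => M q.val) ⟨p, (LTri.mem_cells p).1 hp⟩
        exact congrArg (Prod.mk p) this
      refine ⟨fun q => M q.val, ?_, hE⟩
      rw [LTri.latin_iff, hE]
      exact hl
  rw [this, Set.ncard_coe_finset, List.toFinset_card_of_nodup (LTri.sols_nodup _),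
    LTri.sols_length]
end

section
/- The number of reduced three-rowed Latin trapezoids with base length 5 is exactly 68. -/
/-- The index set of a three-rowed Latin trapezoid with base length `n`:
pairs `(i,j)` with `i ∈ {1,2,3}`, `1 ≤ j` and `j ≤ n + 1 - i`
(equivalently `i + j ≤ n + 1`). -/
def TrapIdx (n : ℕ) : Type :=
  {p : ℕ × ℕ // 1 ≤ p.1 ∧ p.1 ≤ 3 ∧ 1 ≤ p.2 ∧ p.1 + p.2 ≤ n + 1}

/-- `M` is a three-rowed Latin trapezoid with base length `n`: it assigns to
each pair `(i,j)` with `i ∈ {1,2,3}`, `1 ≤ j ≤ n + 1 - i` a value in `{1,…,n}`,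
taking distinct values on each row (same `i`), each left diagonal (same `j`),
and each right diagonal (same `i + j`). -/
def IsLatinTrapezoid (n : ℕ) (M : TrapIdx n → ℕ) : Prop :=
  (∀ p : TrapIdx n, 1 ≤ M p ∧ M p ≤ n) ∧
  (∀ p q : TrapIdx n, p.val.1 = q.val.1 → p ≠ q → M p ≠ M q) ∧
  (∀ p q : TrapIdx n, p.val.2 = q.val.2 → p ≠ q → M p ≠ M q) ∧
  (∀ p q : TrapIdx n, p.val.1 + p.val.2 = q.val.1 + q.val.2 → p ≠ q → M p ≠ M q)

/-- A Latin trapezoid is reduced if its bottom row is the identity: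
`M (1, j) = j` for all `j`. -/
def IsReducedLatinTrapezoid (n : ℕ) (M : TrapIdx n → ℕ) : Prop :=
  ∀ p : TrapIdx n, p.val.1 = 1 → M p = p.val.2

/-- The list of all admissible second and third rows `(a,b,c,d)`, `(e,f,g)`. -/
def trapSols : List (ℕ × ℕ × ℕ × ℕ × ℕ × ℕ × ℕ) :=
  ([1,2,3,4,5].filter fun a => a ≠ 1 ∧ a ≠ 2).flatMap fun a =>
  ([1,2,3,4,5].filter fun b => b ≠ 2 ∧ b ≠ 3 ∧ b ≠ a).flatMap fun b =>
  ([1,2,3,4,5].filter fun c => c ≠ 3 ∧ c ≠ 4 ∧ c ≠ a ∧ c ≠ b).flatMap fun c =>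
  ([1,2,3,4,5].filter fun d => d ≠ 4 ∧ d ≠ 5 ∧ d ≠ a ∧ d ≠ b ∧ d ≠ c).flatMap fun d =>
  ([1,2,3,4,5].filter fun e => e ≠ 1 ∧ e ≠ 3 ∧ e ≠ a ∧ e ≠ b).flatMap fun e =>
  ([1,2,3,4,5].filter fun f => f ≠ 2 ∧ f ≠ 4 ∧ f ≠ b ∧ f ≠ c ∧ f ≠ e).flatMap fun f =>
  ([1,2,3,4,5].filter fun g => g ≠ 3 ∧ g ≠ 5 ∧ g ≠ c ∧ g ≠ d ∧ g ≠ e ∧ g ≠ f).map fun g =>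
  (a, b, c, d, e, f, g)

/-- The filling determined by the second and third rows. -/
def trapFill (t : ℕ × ℕ × ℕ × ℕ × ℕ × ℕ × ℕ) (p : TrapIdx 5) : ℕ :=
  if p.val.1 = 1 then p.val.2
  else if p.val.1 = 2 then
    if p.val.2 = 1 then t.1 else if p.val.2 = 2 then t.2.1
    else if p.val.2 = 3 then t.2.2.1 else t.2.2.2.1
  else
    if p.val.2 = 1 then t.2.2.2.2.1 else if p.val.2 = 2 then t.2.2.2.2.2.1
    else t.2.2.2.2.2.2

instance decEqTrapTuple : DecidableEq (ℕ × ℕ × ℕ × ℕ × ℕ × ℕ × ℕ) :=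
  @instDecidableEqProd _ _ _ <| @instDecidableEqProd _ _ _ <| @instDecidableEqProd _ _ _ <|
  @instDecidableEqProd _ _ _ <| @instDecidableEqProd _ _ _ <| @instDecidableEqProd _ _ _ _

theorem trapSols_card : trapSols.toFinset.card = 68 := by decide +kernel

theorem mem_L (a : ℕ) : a ∈ [1,2,3,4,5] ↔ 1 ≤ a ∧ a ≤ 5 := by
  simp only [List.mem_cons, List.not_mem_nil, or_false]
  omega

theorem mem_trapSols (a b c d e f g : ℕ) : (a, b, c, d, e, f, g) ∈ trapSols ↔
    ((1 ≤ a ∧ a ≤ 5) ∧ a ≠ 1 ∧ a ≠ 2) ∧ ((1 ≤ b ∧ b ≤ 5) ∧ b ≠ 2 ∧ b ≠ 3 ∧ b ≠ a) ∧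
    ((1 ≤ c ∧ c ≤ 5) ∧ c ≠ 3 ∧ c ≠ 4 ∧ c ≠ a ∧ c ≠ b) ∧
    ((1 ≤ d ∧ d ≤ 5) ∧ d ≠ 4 ∧ d ≠ 5 ∧ d ≠ a ∧ d ≠ b ∧ d ≠ c) ∧
    ((1 ≤ e ∧ e ≤ 5) ∧ e ≠ 1 ∧ e ≠ 3 ∧ e ≠ a ∧ e ≠ b) ∧
    ((1 ≤ f ∧ f ≤ 5) ∧ f ≠ 2 ∧ f ≠ 4 ∧ f ≠ b ∧ f ≠ c ∧ f ≠ e) ∧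
    ((1 ≤ g ∧ g ≤ 5) ∧ g ≠ 3 ∧ g ≠ 5 ∧ g ≠ c ∧ g ≠ d ∧ g ≠ e ∧ g ≠ f) := by
  simp only [trapSols, List.mem_flatMap, List.mem_map, List.mem_filter, mem_L, decide_eq_true_eq,
    Prod.mk.injEq]
  constructor
  · rintro ⟨_, h1, _, h2, _, h3, _, h4, _, h5, _, h6, _, h7, rfl, rfl, rfl, rfl, rfl, rfl, rfl⟩
    exact ⟨h1, h2, h3, h4, h5, h6, h7⟩
  · rintro ⟨h1, h2, h3, h4, h5, h6, h7⟩
    exact ⟨_, h1, _, h2, _, h3, _, h4, _, h5, _, h6, _, h7, rfl, rfl, rfl, rfl, rfl, rfl, rfl⟩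

theorem trap_cases (P : TrapIdx 5 → Prop)
    (h11 : P ⟨(1,1), by decide⟩) (h12 : P ⟨(1,2), by decide⟩) (h13 : P ⟨(1,3), by decide⟩)
    (h14 : P ⟨(1,4), by decide⟩) (h15 : P ⟨(1,5), by decide⟩)
    (h21 : P ⟨(2,1), by decide⟩) (h22 : P ⟨(2,2), by decide⟩) (h23 : P ⟨(2,3), by decide⟩)
    (h24 : P ⟨(2,4), by decide⟩)
    (h31 : P ⟨(3,1), by decide⟩) (h32 : P ⟨(3,2), by decide⟩) (h33 : P ⟨(3,3), by decide⟩)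
    (p : TrapIdx 5) : P p := by
  obtain ⟨⟨i, j⟩, h1, h2, h3, h4⟩ := p
  simp only at h1 h2 h3 h4
  have hj : j ≤ 5 := by omega
  interval_cases i <;> interval_cases j <;> first | assumption | omega

theorem trapFill_injective : Function.Injective trapFill := by
  rintro ⟨a, b, c, d, e, f, g⟩ ⟨a2, b2, c2, d2, e2, f2, g2⟩ h
  have h1 := congrFun h ⟨(2,1), by decide⟩
  have h2 := congrFun h ⟨(2,2), by decide⟩
  have h3 := congrFun h ⟨(2,3), by decide⟩
  have h4 := congrFun h ⟨(2,4), by decide⟩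
  have h5 := congrFun h ⟨(3,1), by decide⟩
  have h6 := congrFun h ⟨(3,2), by decide⟩
  have h7 := congrFun h ⟨(3,3), by decide⟩
  simp [trapFill] at h1 h2 h3 h4 h5 h6 h7
  simp [*]

theorem trapFill_latin (t) (ht : t ∈ trapSols) :
    IsLatinTrapezoid 5 (trapFill t) ∧ IsReducedLatinTrapezoid 5 (trapFill t) := by
  obtain ⟨a, b, c, d, e, f, g⟩ := t
  rw [mem_trapSols] at ht
  obtain ⟨⟨⟨_, _⟩, _, _⟩, ⟨⟨_, _⟩, _, _, _⟩, ⟨⟨_, _⟩, _, _, _, _⟩, ⟨⟨_, _⟩, _, _, _, _, _⟩,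
    ⟨⟨_, _⟩, _, _, _, _⟩, ⟨⟨_, _⟩, _, _, _, _, _⟩, ⟨⟨_, _⟩, _, _, _, _, _, _⟩⟩ := ht
  refine ⟨⟨?_, ?_, ?_, ?_⟩, ?_⟩
  · intro p
    induction p using trap_cases <;> simp [trapFill] <;> constructor <;> assumption
  · intro p q hpq hne he
    induction p using trap_cases <;> induction q using trap_cases <;> first
      | exact absurd rfl hne
      | exact absurd hpq (by decide)
      | (simp only [trapFill] at he
         simp at he
         try first
           | exact absurd he (by assumption)
           | exact absurd he.symm (by assumption))
  · intro p q hpq hne he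
    induction p using trap_cases <;> induction q using trap_cases <;> first
      | exact absurd rfl hne
      | exact absurd hpq (by decide)
      | (simp only [trapFill] at he
         simp at he
         try first
           | exact absurd he (by assumption)
           | exact absurd he.symm (by assumption))
  · intro p q hpq hne he
    induction p using trap_cases <;> induction q using trap_cases <;> first
      | exact absurd rfl hne
      | exact absurd hpq (by decide)
      | (simp only [trapFill] at he
         simp at he
         try first
           | exact absurd he (by assumption)
           | exact absurd he.symm (by assumption))
  · intro p hp
    simp [trapFill, hp]

theorem exists_trapFill (M : TrapIdx 5 → ℕ) (hM : IsLatinTrapezoid 5 M)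
    (hr : IsReducedLatinTrapezoid 5 M) : ∃ t ∈ trapSols, trapFill t = M := by
  obtain ⟨hb, h1, h2, h3⟩ := hM
  have ne : ∀ (x y : ℕ × ℕ) (hx) (hy), x ≠ y → (x.1 = y.1 ∨ x.2 = y.2 ∨ x.1 + x.2 = y.1 + y.2) →
      M ⟨x, hx⟩ ≠ M ⟨y, hy⟩ := by
    intro x y hx hy hxy h
    have hne : (⟨x, hx⟩ : TrapIdx 5) ≠ ⟨y, hy⟩ := fun h => hxy (congrArg Subtype.val h)
    rcases h with h | h | h
    · exact h1 _ _ h hne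
    · exact h2 _ _ h hne
    · exact h3 _ _ h hne
  have ne1 : ∀ (x : ℕ × ℕ) (j : ℕ) (hx), 1 ≤ j → j ≤ 5 → x ≠ (1, j) →
      (x.2 = j ∨ x.1 + x.2 = 1 + j) → M ⟨x, hx⟩ ≠ j := by
    intro x j hx hj hj' hxy h
    have hy : 1 ≤ (1, j).1 ∧ (1, j).1 ≤ 3 ∧ 1 ≤ (1, j).2 ∧ (1, j).1 + (1, j).2 ≤ 5 + 1 := by
      simp only; omega
    have := ne x (1, j) hx hy hxy (Or.inr h)
    rwa [hr ⟨(1, j), hy⟩ rfl] at this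
  refine ⟨(M ⟨(2,1), by decide⟩, M ⟨(2,2), by decide⟩, M ⟨(2,3), by decide⟩, M ⟨(2,4), by decide⟩,
    M ⟨(3,1), by decide⟩, M ⟨(3,2), by decide⟩, M ⟨(3,3), by decide⟩), ?_, ?_⟩
  · rw [mem_trapSols]
    refine ⟨⟨hb _, ?_, ?_⟩, ⟨hb _, ?_, ?_, ?_⟩, ⟨hb _, ?_, ?_, ?_, ?_⟩, ⟨hb _, ?_, ?_, ?_, ?_, ?_⟩,
      ⟨hb _, ?_, ?_, ?_, ?_⟩, ⟨hb _, ?_, ?_, ?_, ?_, ?_⟩, ⟨hb _, ?_, ?_, ?_, ?_, ?_, ?_⟩⟩ <;>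
    first
    | exact ne _ _ _ _ (by decide) (by decide)
    | exact ne1 _ _ _ (by decide) (by decide) (by decide) (by decide)
  · funext p
    induction p using trap_cases <;> first | rfl | exact (hr _ rfl).symm

/-- The number of reduced three-rowed Latin trapezoids with base length 5
is exactly 68. -/
theorem reduced_latin_trapezoids_base_5 :
    Set.ncard {M : TrapIdx 5 → ℕ |
      IsLatinTrapezoid 5 M ∧ IsReducedLatinTrapezoid 5 M} = 68 := by
  have : {M : TrapIdx 5 → ℕ | IsLatinTrapezoid 5 M ∧ IsReducedLatinTrapezoid 5 M} =
      Set.image trapFill (trapSols.toFinset : Set (ℕ × ℕ × ℕ × ℕ × ℕ × ℕ × ℕ)) := by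
    ext M
    simp only [Set.mem_ofPred_eq, Set.mem_image, Finset.mem_coe, List.mem_toFinset]
    constructor
    · rintro ⟨h1, h2⟩
      exact exists_trapFill M h1 h2
    · rintro ⟨t, ht, rfl⟩
      exact trapFill_latin t ht
  rw [this, Set.ncard_image_of_injective _ trapFill_injective, Set.ncard_coe_finset, trapSols_card]
end

section
/- The number of reduced three-rowed Latin trapezoids with base length 6 is exactly 1670. -/
/-- Whether the value `v` may be put in the next cell, given the (reversed) list of values already
chosen. The cells are filled in the order `(2,1),…,(2,5),(3,1),…,(3,4)`. -/
def trapForbidden : List ℕ → List ℕ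
  | [] => [1, 2]
  | [a] => [2, 3, a]
  | [b, a] => [3, 4, b, a]
  | [c, b, a] => [4, 5, c, b, a]
  | [d, c, b, a] => [5, 6, d, c, b, a]
  | [_, _, _, b, a] => [1, 3, a, b]
  | [x, _, _, c, b, _] => [2, 4, b, c, x]
  | [y, x, _, d, c, _, _] => [3, 5, c, d, y, x]
  | [z, y, x, e, d, _, _, _] => [4, 6, d, e, z, y, x]
  | _ => []

/-- Boolean membership that reduces well. -/
def trapMem (v : ℕ) : List ℕ → Bool
  | [] => false
  | a :: l => bif Nat.beq v a then true else trapMem v l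

theorem trapMem_eq_false (v : ℕ) (l : List ℕ) : trapMem v l = false ↔ v ∉ l := by
  induction l with
  | nil => simp [trapMem]
  | cons a l ih =>
    by_cases h : v = a
    · simp [trapMem, h]
    · have : Nat.beq v a = false := by
        rw [Bool.eq_false_iff]; intro h'; exact h (Nat.eq_of_beq_eq_true h')
      simp [trapMem, this, ih, h]

/-- All partial fillings of the first `k` cells. -/
def trapList : ℕ → List (List ℕ)
  | 0 => [[]]
  | k + 1 => (trapList k).flatMap fun l =>
      ([1, 2, 3, 4, 5, 6].filter fun v => !(trapMem v (trapForbidden l))).map fun v => v :: l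

theorem mem_trapList_zero (l : List ℕ) : l ∈ trapList 0 ↔ l = [] := by
  simp [trapList]

theorem mem_trapList_succ (k : ℕ) (m : List ℕ) : m ∈ trapList (k + 1) ↔
    ∃ v l, m = v :: l ∧ l ∈ trapList k ∧ (1 ≤ v ∧ v ≤ 6) ∧ v ∉ trapForbidden l := by
  have key : ∀ v : ℕ, v ∈ [1, 2, 3, 4, 5, 6] ↔ (1 ≤ v ∧ v ≤ 6) := by
    intro v; simp; omega
  simp only [trapList, List.mem_flatMap, List.mem_map, List.mem_filter, key,
    Bool.not_eq_true', trapMem_eq_false]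
  constructor
  · rintro ⟨l, hl, v, hv, rfl⟩
    exact ⟨v, l, rfl, hl, hv⟩
  · rintro ⟨v, l, rfl, hl, hv⟩
    exact ⟨l, hl, v, hv, rfl⟩

theorem cons_mem_trapList_succ (k v : ℕ) (l : List ℕ) : v :: l ∈ trapList (k + 1) ↔
    l ∈ trapList k ∧ (1 ≤ v ∧ v ≤ 6) ∧ v ∉ trapForbidden l := by
  rw [mem_trapList_succ]
  constructor
  · rintro ⟨v', l', h, h'⟩
    obtain ⟨rfl, rfl⟩ := List.cons.inj h
    exact h'
  · intro h
    exact ⟨v, l, rfl, h⟩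

theorem nodup_trapList (k : ℕ) : (trapList k).Nodup := by
  induction k with
  | zero => simp [trapList]
  | succ k ih =>
    rw [trapList, List.nodup_flatMap]
    constructor
    · intro l _
      apply List.Nodup.map
      · intro a b h; exact (List.cons.inj h).1
      · exact List.Nodup.filter _ (by decide)
    · refine List.Pairwise.imp ?_ ih
      intro l l' hne
      simp only [Function.onFun, List.disjoint_left, List.mem_map]
      rintro m ⟨v, _, rfl⟩ ⟨v', _, h⟩
      exact hne (List.cons.inj h).2.symm

theorem length_trapList : (trapList 9).length = 1670 := by
  decide +kernel

/-- The cell `(i,j)`. -/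
def trapCell (i j : ℕ) (h : 1 ≤ i ∧ i ≤ 3 ∧ 1 ≤ j ∧ i + j ≤ 7) : TrapIdx 6 := ⟨(i, j), h⟩

/-- The list of values in rows 2 and 3. -/
def trapToList (M : TrapIdx 6 → ℕ) : List ℕ :=
  [M (trapCell 3 4 (by decide)), M (trapCell 3 3 (by decide)), M (trapCell 3 2 (by decide)),
   M (trapCell 3 1 (by decide)), M (trapCell 2 5 (by decide)), M (trapCell 2 4 (by decide)),
   M (trapCell 2 3 (by decide)), M (trapCell 2 2 (by decide)), M (trapCell 2 1 (by decide))]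

/-- The trapezoid as a function on pairs, given rows 2 and 3. -/
def trapFun (a b c d e x y z w : ℕ) : ℕ → ℕ → ℕ
  | 1, j => j
  | 2, 1 => a
  | 2, 2 => b
  | 2, 3 => c
  | 2, 4 => d
  | 2, 5 => e
  | 3, 1 => x
  | 3, 2 => y
  | 3, 3 => z
  | 3, 4 => w
  | _, _ => 0

theorem trap_cases_s13 {P : TrapIdx 6 → Prop} (h1 : ∀ j h, P (trapCell 1 j h))
    (h2 : ∀ j h, P (trapCell 2 j h)) (h3 : ∀ j h, P (trapCell 3 j h)) (p : TrapIdx 6) : P p := by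
  obtain ⟨⟨i, j⟩, h⟩ := p
  have hi := h.1
  have hi' := h.2.1
  dsimp only at hi hi'
  interval_cases i
  · exact h1 j h
  · exact h2 j h
  · exact h3 j h

theorem trapToList_injOn : Set.InjOn trapToList {M : TrapIdx 6 → ℕ |
      IsLatinTrapezoid 6 M ∧ IsReducedLatinTrapezoid 6 M} := by
  rintro M ⟨-, hM⟩ N ⟨-, hN⟩ h
  simp only [trapToList, List.cons.injEq, and_true] at h
  obtain ⟨h34, h33, h32, h31, h25, h24, h23, h22, h21⟩ := h
  funext p
  induction p using trap_cases_s13 with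
  | h1 j h => rw [hM _ rfl, hN _ rfl]
  | h2 j h =>
    have hj : 1 ≤ j := h.2.2.1
    have hj' : j ≤ 5 := by omega
    interval_cases j <;> assumption
  | h3 j h =>
    have hj : 1 ≤ j := h.2.2.1
    have hj' : j ≤ 4 := by omega
    interval_cases j <;> assumption

theorem trapCell_ne {i j k l : ℕ} (h h') (hne : i ≠ k ∨ j ≠ l) :
    trapCell i j h ≠ trapCell k l h' := by
  intro e
  have := congrArg Subtype.val e
  simp only [trapCell, Prod.mk.injEq] at this
  omega

theorem trapToList_mem (M : TrapIdx 6 → ℕ) (hM : IsLatinTrapezoid 6 M)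
    (hR : IsReducedLatinTrapezoid 6 M) : trapToList M ∈ trapList 9 := by
  obtain ⟨hb, hr, hl, hd⟩ := hM
  have row : ∀ i j k h h', j ≠ k → M (trapCell i j h) ≠ M (trapCell i k h') :=
    fun i j k h h' e => hr _ _ rfl (trapCell_ne _ _ (Or.inr e))
  have col : ∀ i j k h h', i ≠ k → M (trapCell i j h) ≠ M (trapCell k j h') :=
    fun i j k h h' e => hl _ _ rfl (trapCell_ne _ _ (Or.inl e))
  have dia : ∀ i j k l h h', i + j = k + l → i ≠ k → M (trapCell i j h) ≠ M (trapCell k l h') :=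
    fun i j k l h h' s e => hd _ _ s (trapCell_ne _ _ (Or.inl e))
  have red : ∀ j h, M (trapCell 1 j h) = j := fun j h => hR _ rfl
  have col1 : ∀ i j h, i ≠ 1 → M (trapCell i j h) ≠ j := by
    intro i j h hi
    have := col i j 1 h (by omega) hi
    rwa [red] at this
  have dia1 : ∀ i j n h, i ≠ 1 → n + 1 = i + j → M (trapCell i j h) ≠ n := by
    intro i j n h hi hn
    have := dia i j 1 n h (by omega) (by omega) hi
    rwa [red] at this
  simp only [trapToList, cons_mem_trapList_succ, mem_trapList_zero, trapForbidden, List.mem_cons,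
    List.not_mem_nil, or_false, not_or, true_and]
  refine ⟨⟨⟨⟨⟨⟨⟨⟨⟨?_, ?_⟩, ?_, ?_⟩, ?_, ?_⟩, ?_, ?_⟩, ?_, ?_⟩, ?_, ?_⟩, ?_, ?_⟩, ?_, ?_⟩, ?_, ?_⟩ <;>
    first
    | exact hb _
    | (refine ⟨?_, ?_⟩ <;> first
        | exact col1 _ _ _ (by decide)
        | exact dia1 _ _ _ _ (by decide) (by decide))
    | (refine ⟨?_, ?_, ?_⟩ <;> first
        | exact col1 _ _ _ (by decide)
        | exact dia1 _ _ _ _ (by decide) (by decide)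
        | exact row _ _ _ _ _ (by decide))
    | (refine ⟨?_, ?_, ?_, ?_⟩ <;> first
        | exact col1 _ _ _ (by decide)
        | exact dia1 _ _ _ _ (by decide) (by decide)
        | exact row _ _ _ _ _ (by decide)
        | exact col _ _ _ _ _ (by decide)
        | exact dia _ _ _ _ _ _ (by decide) (by decide))
    | (refine ⟨?_, ?_, ?_, ?_, ?_⟩ <;> first
        | exact col1 _ _ _ (by decide)
        | exact dia1 _ _ _ _ (by decide) (by decide)
        | exact row _ _ _ _ _ (by decide)
        | exact col _ _ _ _ _ (by decide)
        | exact dia _ _ _ _ _ _ (by decide) (by decide))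
    | (refine ⟨?_, ?_, ?_, ?_, ?_, ?_⟩ <;> first
        | exact col1 _ _ _ (by decide)
        | exact dia1 _ _ _ _ (by decide) (by decide)
        | exact row _ _ _ _ _ (by decide)
        | exact col _ _ _ _ _ (by decide)
        | exact dia _ _ _ _ _ _ (by decide) (by decide))
    | (refine ⟨?_, ?_, ?_, ?_, ?_, ?_, ?_⟩ <;> first
        | exact col1 _ _ _ (by decide)
        | exact dia1 _ _ _ _ (by decide) (by decide)
        | exact row _ _ _ _ _ (by decide)
        | exact col _ _ _ _ _ (by decide)
        | exact dia _ _ _ _ _ _ (by decide) (by decide))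

set_option maxHeartbeats 4000000 in
theorem exists_of_mem_trapList (l : List ℕ) (hl : l ∈ trapList 9) :
    ∃ M, (IsLatinTrapezoid 6 M ∧ IsReducedLatinTrapezoid 6 M) ∧ trapToList M = l := by
  have hl0 := hl
  obtain ⟨w, l, rfl, hl, -⟩ := (mem_trapList_succ _ _).1 hl
  obtain ⟨z, l, rfl, hl, -⟩ := (mem_trapList_succ _ _).1 hl
  obtain ⟨y, l, rfl, hl, -⟩ := (mem_trapList_succ _ _).1 hl
  obtain ⟨x, l, rfl, hl, -⟩ := (mem_trapList_succ _ _).1 hl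
  obtain ⟨e, l, rfl, hl, -⟩ := (mem_trapList_succ _ _).1 hl
  obtain ⟨d, l, rfl, hl, -⟩ := (mem_trapList_succ _ _).1 hl
  obtain ⟨c, l, rfl, hl, -⟩ := (mem_trapList_succ _ _).1 hl
  obtain ⟨b, l, rfl, hl, -⟩ := (mem_trapList_succ _ _).1 hl
  obtain ⟨a, l, rfl, hl, -⟩ := (mem_trapList_succ _ _).1 hl
  rw [mem_trapList_zero] at hl
  subst hl
  simp only [cons_mem_trapList_succ, mem_trapList_zero, trapForbidden, List.mem_cons,
    List.not_mem_nil, or_false, not_or, true_and] at hl0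
  obtain ⟨⟨⟨⟨⟨⟨⟨⟨⟨ba, a1, a2⟩, bb, b1, b2, b3⟩, bc, c1, c2, c3, c4⟩, bd, d1, d2, d3, d4, d5⟩,
    be, e1, e2, e3, e4, e5, e6⟩, bx, x1, x2, x3, x4⟩, bY, y1, y2, y3, y4, y5⟩,
    bz, z1, z2, z3, z4, z5, z6⟩, bw, w1, w2, w3, w4, w5, w6, w7⟩ := hl0
  have main : ∀ i j k l : ℕ, 1 ≤ i → i ≤ 3 → 1 ≤ j → i + j ≤ 7 → 1 ≤ k → k ≤ 3 → 1 ≤ l →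
      k + l ≤ 7 → (i = k ∨ j = l ∨ i + j = k + l) → ¬ (i = k ∧ j = l) →
      trapFun a b c d e x y z w i j ≠ trapFun a b c d e x y z w k l := by
    intro i j k l hi hi' hj hij hk hk' hl hkl hc hn
    have hj' : j ≤ 6 := by omega
    have hl' : l ≤ 6 := by omega
    interval_cases i <;> interval_cases j <;> first
      | (exfalso; omega)
      | (interval_cases k <;> interval_cases l <;> first
          | (exfalso; omega)
          | (simp only [trapFun]; first | assumption | (apply Ne.symm; assumption) | decide))
  have bound : ∀ i j : ℕ, 1 ≤ i → i ≤ 3 → 1 ≤ j → i + j ≤ 7 →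
      1 ≤ trapFun a b c d e x y z w i j ∧ trapFun a b c d e x y z w i j ≤ 6 := by
    intro i j hi hi' hj hij
    have hj' : j ≤ 6 := by omega
    interval_cases i <;> interval_cases j <;> first
      | (exfalso; omega)
      | (simp only [trapFun]; first | assumption | decide)
  have ne : ∀ p q : TrapIdx 6, p ≠ q → ¬ (p.val.1 = q.val.1 ∧ p.val.2 = q.val.2) := by
    intro p q hpq h
    exact hpq (Subtype.ext (Prod.ext h.1 h.2))
  refine ⟨fun p => trapFun a b c d e x y z w p.val.1 p.val.2, ⟨⟨?_, ?_, ?_, ?_⟩, ?_⟩, rfl⟩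
  · rintro ⟨p, h1, h2, h3, h4⟩
    exact bound _ _ h1 h2 h3 h4
  · intro p q h hpq
    exact main _ _ _ _ p.2.1 p.2.2.1 p.2.2.2.1 p.2.2.2.2 q.2.1 q.2.2.1 q.2.2.2.1 q.2.2.2.2
      (Or.inl h) (ne p q hpq)
  · intro p q h hpq
    exact main _ _ _ _ p.2.1 p.2.2.1 p.2.2.2.1 p.2.2.2.2 q.2.1 q.2.2.1 q.2.2.2.1 q.2.2.2.2
      (Or.inr (Or.inl h)) (ne p q hpq)
  · intro p q h hpq
    exact main _ _ _ _ p.2.1 p.2.2.1 p.2.2.2.1 p.2.2.2.2 q.2.1 q.2.2.1 q.2.2.2.1 q.2.2.2.2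
      (Or.inr (Or.inr h)) (ne p q hpq)
  · intro p hp
    simp only [hp, trapFun]

/-- The number of reduced three-rowed Latin trapezoids with base length 6
is exactly 1670. -/
theorem reduced_latin_trapezoids_base_6 :
    Set.ncard {M : TrapIdx 6 → ℕ |
      IsLatinTrapezoid 6 M ∧ IsReducedLatinTrapezoid 6 M} = 1670 := by
  rw [← Set.ncard_image_of_injOn trapToList_injOn]
  have : trapToList '' {M : TrapIdx 6 → ℕ |
      IsLatinTrapezoid 6 M ∧ IsReducedLatinTrapezoid 6 M} = ((trapList 9).toFinset : Set _) := by
    ext l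
    simp only [Set.mem_image, Set.mem_setOf_eq, Finset.mem_coe, List.mem_toFinset]
    constructor
    · rintro ⟨M, ⟨h, h'⟩, rfl⟩
      exact trapToList_mem M h h'
    · exact exists_of_mem_trapList l
  rw [this, Set.ncard_coe_finset, List.toFinset_card_of_nodup (nodup_trapList 9), length_trapList]
end

section
/- The number of reduced three-rowed Latin trapezoids with base length 7 is exactly 67295. -/
namespace LatinTrap

/-- Sum of `F v` over the `v ∈ {1,…,7}` whose bit is not set in `m`. -/
def sumv (F : ℕ → ℕ) (m : ℕ) : ℕ :=
  [1,2,3,4,5,6,7].foldr (fun v s => (bif m.testBit v then 0 else F v) + s) 0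

/-- Number of lists of distinct values avoiding the given bit masks. -/
def cnt : List ℕ → ℕ → ℕ
  | [] => fun _ => 1
  | f :: fs => fun u => sumv (fun v => cnt fs (u ||| 1 <<< v)) (f ||| u)

/-- The lists counted by `cnt`. -/
def enum : List ℕ → ℕ → List (List ℕ)
  | [] => fun _ => [[]]
  | f :: fs => fun u => [1,2,3,4,5,6,7].flatMap fun v =>
      bif (f ||| u).testBit v then [] else (enum fs (u ||| 1 <<< v)).map (v :: ·)

/-- Kernel-friendly version of `sumv`: `F` receives the bit `2 ^ v`. -/
def sumF (F : ℕ → ℕ) (m : ℕ) : ℕ :=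
  Nat.add (cond (Nat.beq (Nat.land m 2) 0) (F 2) 0) (
  Nat.add (cond (Nat.beq (Nat.land m 4) 0) (F 4) 0) (
  Nat.add (cond (Nat.beq (Nat.land m 8) 0) (F 8) 0) (
  Nat.add (cond (Nat.beq (Nat.land m 16) 0) (F 16) 0) (
  Nat.add (cond (Nat.beq (Nat.land m 32) 0) (F 32) 0) (
  Nat.add (cond (Nat.beq (Nat.land m 64) 0) (F 64) 0)
    (cond (Nat.beq (Nat.land m 128) 0) (F 128) 0))))))

/-- Kernel-friendly version of `cnt`. -/
noncomputable def cntF (l : List ℕ) : ℕ → ℕ :=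
  List.rec (fun _ => 1) (fun f _ ih u => sumF (fun w => ih (Nat.lor u w)) (Nat.lor f u)) l

theorem beq_land (m v : ℕ) : Nat.beq (Nat.land m (2 ^ v)) 0 = !m.testBit v := by
  have h : Nat.land m (2 ^ v) = (m.testBit v).toNat * 2 ^ v := Nat.and_two_pow m v
  rw [h]
  cases m.testBit v
  · simp
  · simp only [Bool.toNat_true, one_mul, Bool.not_true]
    rw [Bool.eq_false_iff, ne_eq, Nat.beq_eq]
    positivity

theorem sumF_eq (F : ℕ → ℕ) (m : ℕ) : sumF F m = sumv (fun v => F (1 <<< v)) m := by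
  have h1 := beq_land m 1
  have h2 := beq_land m 2
  have h3 := beq_land m 3
  have h4 := beq_land m 4
  have h5 := beq_land m 5
  have h6 := beq_land m 6
  have h7 := beq_land m 7
  norm_num only at h1 h2 h3 h4 h5 h6 h7
  unfold sumF sumv
  rw [h1, h2, h3, h4, h5, h6, h7]
  simp only [Bool.cond_not, List.foldr]
  rfl

theorem cntF_eq (l : List ℕ) : ∀ u, cntF l u = cnt l u := by
  induction l with
  | nil => intro u; rfl
  | cons f fs ih =>
    intro u
    have : cntF (f :: fs) u = sumF (fun w => cntF fs (Nat.lor u w)) (Nat.lor f u) := rfl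
    rw [this, sumF_eq]
    simp only [ih]
    rfl

/-- Sum of `k l` over the lists `l` in `enum`, arranged as a shallow tree. -/
def sumE : List ℕ → ℕ → (List ℕ → ℕ) → ℕ
  | [] => fun _ k => k []
  | f :: fs => fun u k => sumv (fun v => sumE fs (u ||| 1 <<< v) (fun l => k (v :: l))) (f ||| u)

theorem sumE_eq (fs : List ℕ) : ∀ u k, sumE fs u k = ((enum fs u).map k).sum := by
  induction fs with
  | nil => intro u k; simp [sumE, enum]
  | cons f fs ih =>
    intro u k
    have hc : ∀ (b : Bool) (l : List (List ℕ)),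
        ((bif b then [] else l).map k).sum = bif b then 0 else (l.map k).sum := by
      intro b l; cases b <;> simp
    simp only [sumE, enum, sumv, List.foldr, List.flatMap_cons, List.flatMap_nil, List.map_append,
      List.sum_append, hc, ih, List.map_map, List.map_nil, List.sum_nil, Function.comp_def]

theorem length_enum (fs : List ℕ) : ∀ u, (enum fs u).length = cnt fs u := by
  induction fs with
  | nil => intro u; rfl
  | cons f fs ih =>
    intro u
    simp only [enum, cnt, sumv, List.length_flatMap, List.map, List.sum_cons, List.sum_nil,
      List.foldr, Bool.apply_cond List.length, List.length_map, List.length_nil, ih]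

theorem nodup_enum (fs : List ℕ) : ∀ u, (enum fs u).Nodup := by
  induction fs with
  | nil => intro u; simp [enum]
  | cons f fs ih =>
    intro u
    simp only [enum]
    rw [List.nodup_flatMap]
    constructor
    · intro v _
      cases (f ||| u).testBit v
      · exact (ih _).map (fun a b h => by simpa using h)
      · simp
    · refine List.Pairwise.imp (R := fun a b => a ≠ b) ?_ (by decide)
      intro a b hab l h1 h2
      cases ha : (f ||| u).testBit a <;> cases hb : (f ||| u).testBit b <;>
        simp [ha, hb] at h1 h2
      obtain ⟨_, _, rfl⟩ := h1
      obtain ⟨_, _, h⟩ := h2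
      simp at h
      exact hab h.1.symm

theorem mem_enum (fs : List ℕ) : ∀ u l, l ∈ enum fs u ↔
    List.Forall₂ (fun f v => (1 ≤ v ∧ v ≤ 7) ∧ f.testBit v = false) fs l ∧ l.Nodup ∧
      ∀ v ∈ l, u.testBit v = false := by
  induction fs with
  | nil => intro u l; cases l <;> simp [enum]
  | cons f fs ih =>
    intro u l
    have hmem : ∀ v : ℕ, v ∈ [1,2,3,4,5,6,7] ↔ 1 ≤ v ∧ v ≤ 7 := by
      intro v; simp; omega
    simp only [enum, List.mem_flatMap, hmem]
    cases l with
    | nil =>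
      simp
      intro v _ _
      cases (f.testBit v || u.testBit v) <;> simp
    | cons w l =>
      have key : (∃ a, (1 ≤ a ∧ a ≤ 7) ∧ w :: l ∈ bif (f ||| u).testBit a then []
            else (enum fs (u ||| 1 <<< a)).map (a :: ·)) ↔
          (1 ≤ w ∧ w ≤ 7) ∧ (f ||| u).testBit w = false ∧ l ∈ enum fs (u ||| 1 <<< w) := by
        constructor
        · rintro ⟨a, ha, h⟩
          cases hb : (f ||| u).testBit a
          · rw [hb] at h
            simp only [cond_false, List.mem_map, List.cons.injEq] at h
            obtain ⟨l', h1, rfl, rfl⟩ := h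
            exact ⟨ha, hb, h1⟩
          · rw [hb] at h; simp at h
        · rintro ⟨h1, h2, h3⟩
          refine ⟨w, h1, ?_⟩
          rw [h2]
          simpa using h3
      rw [key, ih]
      have ht : ∀ v, (1 <<< w).testBit v = decide (w = v) := by
        intro v
        rw [Nat.one_shiftLeft, Nat.testBit_two_pow]
      simp only [List.forall₂_cons, Nat.testBit_or, ht, List.nodup_cons, List.mem_cons,
        Bool.or_eq_false_iff, decide_eq_false_iff_not]
      constructor
      · rintro ⟨h1, ⟨h2, h3⟩, h4, h5, h6⟩
        refine ⟨⟨⟨h1, h2⟩, h4⟩, ⟨fun h => (h6 _ h).2 rfl, h5⟩, ?_⟩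
        rintro v (rfl | hv)
        · exact h3
        · exact (h6 v hv).1
      · rintro ⟨⟨⟨h1, h2⟩, h4⟩, ⟨h5, h6⟩, h7⟩
        refine ⟨h1, ⟨h2, h7 _ (Or.inl rfl)⟩, h4, h6, fun v hv => ⟨h7 v (Or.inr hv), ?_⟩⟩
        rintro rfl
        exact h5 hv

/-- Forbidden masks for the second row: `{j, j+1}`. -/
def maskB : List ℕ := [6, 12, 24, 48, 96, 192]

/-- Forbidden masks for the third row: `{j, j+2, b_j, b_{j+1}}`. -/
def maskC : List ℕ → List ℕ
  | [a, b, c, d, e, f] =>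
    [10 ||| (1 <<< a ||| 1 <<< b), 20 ||| (1 <<< b ||| 1 <<< c), 40 ||| (1 <<< c ||| 1 <<< d),
      80 ||| (1 <<< d ||| 1 <<< e), 160 ||| (1 <<< e ||| 1 <<< f)]
  | _ => []

/-- All pairs (second row, third row). -/
def pairs : List (List ℕ × List ℕ) :=
  (enum maskB 0).flatMap fun b => (enum (maskC b) 0).map fun c => (b, c)

theorem nodup_pairs : pairs.Nodup := by
  unfold pairs
  rw [List.nodup_flatMap]
  constructor
  · intro b _
    exact (nodup_enum _ _).map (fun a b h => by simpa using h)
  · refine List.Pairwise.imp (R := fun a b => a ≠ b) ?_ (nodup_enum _ _)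
    intro a b hab l h1 h2
    simp only [List.mem_map] at h1 h2
    obtain ⟨_, _, rfl⟩ := h1
    obtain ⟨_, _, h⟩ := h2
    exact hab (congrArg Prod.fst h).symm

theorem sum_count_fast : sumE maskB 0 (fun b => cntF (maskC b) 0) = 67295 := by
  decide +kernel

theorem sum_count : ((enum maskB 0).map fun b => cnt (maskC b) 0).sum = 67295 := by
  rw [← sum_count_fast, sumE_eq]
  simp only [cntF_eq]

theorem length_pairs : pairs.length = 67295 := by
  rw [← sum_count]
  simp only [pairs, List.length_flatMap, List.length_map, length_enum]

/-- Explicit description of a valid pair. -/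
theorem mem_pairs (b c : List ℕ) : (b, c) ∈ pairs ↔
    b ∈ enum maskB 0 ∧ c ∈ enum (maskC b) 0 := by
  simp [pairs]

/-- An index. -/
def ix (i j : ℕ) (h : 1 ≤ i ∧ i ≤ 3 ∧ 1 ≤ j ∧ i + j ≤ 7 + 1) : TrapIdx 7 := ⟨(i, j), h⟩

/-- Rows two and three of a trapezoid. -/
def rows (M : TrapIdx 7 → ℕ) : List ℕ × List ℕ :=
  ([M (ix 2 1 (by decide)), M (ix 2 2 (by decide)), M (ix 2 3 (by decide)),
    M (ix 2 4 (by decide)), M (ix 2 5 (by decide)), M (ix 2 6 (by decide))],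
   [M (ix 3 1 (by decide)), M (ix 3 2 (by decide)), M (ix 3 3 (by decide)),
    M (ix 3 4 (by decide)), M (ix 3 5 (by decide))])

/-- Rebuild a trapezoid from its rows two and three. -/
def build (b c : List ℕ) (p : TrapIdx 7) : ℕ :=
  if p.val.1 = 1 then p.val.2 else
    if p.val.1 = 2 then b.getD (p.val.2 - 1) 0 else c.getD (p.val.2 - 1) 0

theorem build_rows (M : TrapIdx 7 → ℕ) (h : IsReducedLatinTrapezoid 7 M) :
    build (rows M).1 (rows M).2 = M := by
  funext p
  have hp := h p
  obtain ⟨⟨i, j⟩, h1, h2, h3, h4⟩ := p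
  simp only at h1 h2 h3 h4 hp
  unfold build rows
  interval_cases i
  · simp only [if_true]; exact (hp rfl).symm
  · have : j ≤ 6 := by omega
    interval_cases j <;> rfl
  · have : j ≤ 5 := by omega
    interval_cases j <;> rfl

theorem mask_eq (v : ℕ) (h : 1 ≤ v ∧ v ≤ 7) :
    (Nat.testBit 6 v = false ↔ v ≠ 1 ∧ v ≠ 2) ∧
    (Nat.testBit 12 v = false ↔ v ≠ 2 ∧ v ≠ 3) ∧
    (Nat.testBit 24 v = false ↔ v ≠ 3 ∧ v ≠ 4) ∧
    (Nat.testBit 48 v = false ↔ v ≠ 4 ∧ v ≠ 5) ∧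
    (Nat.testBit 96 v = false ↔ v ≠ 5 ∧ v ≠ 6) ∧
    (Nat.testBit 192 v = false ↔ v ≠ 6 ∧ v ≠ 7) ∧
    (Nat.testBit 10 v = false ↔ v ≠ 1 ∧ v ≠ 3) ∧
    (Nat.testBit 20 v = false ↔ v ≠ 2 ∧ v ≠ 4) ∧
    (Nat.testBit 40 v = false ↔ v ≠ 3 ∧ v ≠ 5) ∧
    (Nat.testBit 80 v = false ↔ v ≠ 4 ∧ v ≠ 6) ∧
    (Nat.testBit 160 v = false ↔ v ≠ 5 ∧ v ≠ 7) := by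
  obtain ⟨h1, h2⟩ := h
  interval_cases v <;> decide

theorem testBit_or_shift (m x y v : ℕ) : (m ||| (1 <<< x ||| 1 <<< y)).testBit v = false ↔
    m.testBit v = false ∧ x ≠ v ∧ y ≠ v := by
  simp only [Nat.testBit_or, Nat.one_shiftLeft, Nat.testBit_two_pow, Bool.or_eq_false_iff,
    decide_eq_false_iff_not, ne_eq]

theorem rows_mem (M : TrapIdx 7 → ℕ) (h : IsLatinTrapezoid 7 M)
    (hr : IsReducedLatinTrapezoid 7 M) : rows M ∈ pairs := by
  obtain ⟨h1, h2, h3, h4⟩ := h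
  have ne : ∀ (i j k l : ℕ) (hp hq), (i, j) ≠ (k, l) → ix i j hp ≠ ix k l hq := by
    intro i j k l hp hq hne he
    exact hne (congrArg Subtype.val he)
  have R : ∀ (i j l : ℕ) (hp hq), j ≠ l → M (ix i j hp) ≠ M (ix i l hq) := by
    intro i j l hp hq hne
    exact h2 _ _ rfl (ne _ _ _ _ _ _ (by simpa using hne))
  have L : ∀ (i k j : ℕ) (hp hq), i ≠ k → M (ix i j hp) ≠ M (ix k j hq) := by
    intro i k j hp hq hne
    exact h3 _ _ rfl (ne _ _ _ _ _ _ (by simpa using hne))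
  have D : ∀ (i j k l : ℕ) (hp hq), i + j = k + l → i ≠ k → M (ix i j hp) ≠ M (ix k l hq) := by
    intro i j k l hp hq he hne
    exact h4 _ _ he (ne _ _ _ _ _ _ (by simp [hne]))
  have L1 : ∀ (i j : ℕ) (hp), i ≠ 1 → M (ix i j hp) ≠ j := by
    intro i j hp hi
    have h' : 1 ≤ 1 ∧ 1 ≤ 3 ∧ 1 ≤ j ∧ 1 + j ≤ 7 + 1 := by omega
    have := L i 1 j hp h' hi
    rwa [hr (ix 1 j h') rfl] at this
  have D1 : ∀ (i j l : ℕ) (hp), i ≠ 1 → i + j = l + 1 → M (ix i j hp) ≠ l := by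
    intro i j l hp hi he
    have h' : 1 ≤ 1 ∧ 1 ≤ 3 ∧ 1 ≤ l ∧ 1 + l ≤ 7 + 1 := by omega
    have := D i j 1 l hp h' (by omega) hi
    rwa [hr (ix 1 l h') rfl] at this
  unfold rows
  rw [mem_pairs, mem_enum, mem_enum]
  simp only [maskB, maskC, List.forall₂_cons, List.forall₂_nil_left_iff, testBit_or_shift,
    Nat.zero_testBit, implies_true, and_true, mask_eq _ (h1 _), List.nodup_cons, List.mem_cons,
    List.not_mem_nil, or_false, not_or, List.nodup_nil, not_false_eq_true]
  refine ⟨⟨?_, ?_⟩, ?_, ?_⟩ <;> repeat' apply And.intro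
  all_goals first
    | exact (h1 _).1
    | exact (h1 _).2
    | exact R _ _ _ _ _ (by decide)
    | exact L1 _ _ _ (by decide)
    | exact D1 _ _ _ _ (by decide) (by decide)
    | exact L _ _ _ _ _ (by decide)
    | exact D _ _ _ _ _ _ (by decide) (by decide)

set_option maxHeartbeats 1000000 in
theorem build_mem (b c : List ℕ) (h : (b, c) ∈ pairs) :
    (IsLatinTrapezoid 7 (build b c) ∧ IsReducedLatinTrapezoid 7 (build b c)) ∧
      rows (build b c) = (b, c) := by
  rw [mem_pairs, mem_enum, mem_enum] at h
  obtain ⟨⟨hb1, hb2, -⟩, hc1, hc2, -⟩ := h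
  simp only [maskB, List.forall₂_cons_left_iff, List.forall₂_nil_left_iff] at hb1
  obtain ⟨b1, _, ⟨r1, m1⟩, ⟨b2, _, ⟨r2, m2⟩, ⟨b3, _, ⟨r3, m3⟩, ⟨b4, _, ⟨r4, m4⟩, ⟨b5, _, ⟨r5, m5⟩,
    ⟨b6, _, ⟨r6, m6⟩, rfl, rfl⟩, rfl⟩, rfl⟩, rfl⟩, rfl⟩, rfl⟩ := hb1
  simp only [maskC, List.forall₂_cons_left_iff, List.forall₂_nil_left_iff] at hc1
  obtain ⟨c1, _, ⟨s1, n1⟩, ⟨c2, _, ⟨s2, n2⟩, ⟨c3, _, ⟨s3, n3⟩, ⟨c4, _, ⟨s4, n4⟩, ⟨c5, _, ⟨s5, n5⟩,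
    rfl, rfl⟩, rfl⟩, rfl⟩, rfl⟩, rfl⟩ := hc1
  simp only [testBit_or_shift, mask_eq _ r1, mask_eq _ r2, mask_eq _ r3, mask_eq _ r4,
    mask_eq _ r5, mask_eq _ r6, mask_eq _ s1, mask_eq _ s2, mask_eq _ s3, mask_eq _ s4,
    mask_eq _ s5] at m1 m2 m3 m4 m5 m6 n1 n2 n3 n4 n5
  simp only [List.nodup_cons, List.mem_cons, List.not_mem_nil, or_false, not_or, List.nodup_nil,
    not_false_eq_true, and_true] at hb2 hc2
  obtain ⟨⟨_, _, _, _, _⟩, ⟨_, _, _, _⟩, ⟨_, _, _⟩, ⟨_, _⟩, _⟩ := hb2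
  obtain ⟨⟨_, _, _, _⟩, ⟨_, _, _⟩, ⟨_, _⟩, _⟩ := hc2
  obtain ⟨⟨⟨_, _⟩, _, _⟩, ⟨⟨_, _⟩, _, _⟩, ⟨⟨_, _⟩, _, _⟩⟩ := And.intro n1 (And.intro n2 n3)
  obtain ⟨⟨⟨_, _⟩, _, _⟩, ⟨⟨_, _⟩, _, _⟩⟩ := And.intro n4 n5
  obtain ⟨⟨_, _⟩, ⟨_, _⟩, ⟨_, _⟩⟩ := And.intro m1 (And.intro m2 m3)
  obtain ⟨⟨_, _⟩, ⟨_, _⟩, ⟨_, _⟩⟩ := And.intro m4 (And.intro m5 m6)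
  refine ⟨⟨⟨?_, ?_, ?_, ?_⟩, ?_⟩, rfl⟩
  · rintro ⟨⟨i, j⟩, h1, h2, h3, h4⟩
    simp only at h1 h2 h3 h4
    unfold build
    simp only
    interval_cases i
    · exact ⟨h3, by clear * - h4; simp; omega⟩
    · have : j ≤ 6 := by clear * - h4; omega
      interval_cases j <;> assumption
    · have : j ≤ 5 := by clear * - h4; omega
      interval_cases j <;> assumption
  · rintro ⟨⟨i, j⟩, h1, h2, h3, h4⟩ ⟨⟨k, l⟩, g1, g2, g3, g4⟩ he hne
    simp only at h1 h2 h3 h4 g1 g2 g3 g4 he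
    subst he
    have hjl : j ≠ l := by
      rintro rfl; exact hne rfl
    unfold build
    simp only
    interval_cases i
    · simpa using hjl
    · have : j ≤ 6 := by clear * - h1 h4; omega
      have : l ≤ 6 := by clear * - h1 g4; omega
      interval_cases j <;> interval_cases l <;> first | exact absurd rfl hjl | (simp only [List.getD_cons_zero, List.getD_cons_succ, reduceIte, Nat.reduceSub, Nat.reduceEqDiff]; first | assumption | (apply Ne.symm; assumption))
    · have : j ≤ 5 := by clear * - h1 h4; omega
      have : l ≤ 5 := by clear * - h1 g4; omega
      interval_cases j <;> interval_cases l <;> first | exact absurd rfl hjl | (simp only [List.getD_cons_zero, List.getD_cons_succ, reduceIte, Nat.reduceSub, Nat.reduceEqDiff]; first | assumption | (apply Ne.symm; assumption))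
  · rintro ⟨⟨i, j⟩, h1, h2, h3, h4⟩ ⟨⟨k, l⟩, g1, g2, g3, g4⟩ he hne
    simp only at h1 h2 h3 h4 g1 g2 g3 g4 he
    subst he
    have hik : i ≠ k := by
      rintro rfl; exact hne rfl
    unfold build
    simp only
    have : j ≤ 6 := by clear * - h1 h4 g1 g4 hik; omega
    interval_cases i <;> interval_cases k <;> first | exact absurd rfl hik | skip
    all_goals interval_cases j <;> first | (exfalso; clear * - h4 g4; omega) | (simp only [List.getD_cons_zero, List.getD_cons_succ, reduceIte, Nat.reduceSub, Nat.reduceEqDiff]; first | assumption | (apply Ne.symm; assumption))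
  · rintro ⟨⟨i, j⟩, h1, h2, h3, h4⟩ ⟨⟨k, l⟩, g1, g2, g3, g4⟩ he hne
    simp only at h1 h2 h3 h4 g1 g2 g3 g4 he
    have hik : i ≠ k := by
      rintro rfl
      have : j = l := by clear * - he; omega
      subst this
      exact hne rfl
    unfold build
    simp only
    have hl : l = i + j - k := by clear * - he; omega
    have : j ≤ 7 := by clear * - h1 h4; omega
    subst hl
    interval_cases i <;> interval_cases k <;> first | exact absurd rfl hik | skip
    all_goals
      interval_cases j <;>
      first
      | (exfalso; clear * - he g3 h4 g4; omega)
      | (simp only [List.getD_cons_zero, List.getD_cons_succ, reduceIte, Nat.reduceSub, Nat.reduceEqDiff]; first | assumption | (apply Ne.symm; assumption))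
  · rintro ⟨⟨i, j⟩, h1, h2, h3, h4⟩ hi
    simp only at hi
    simp [build, hi]

theorem main_count :
    Set.ncard {M : TrapIdx 7 → ℕ |
      IsLatinTrapezoid 7 M ∧ IsReducedLatinTrapezoid 7 M} = 67295 := by
  rw [← length_pairs, ← List.toFinset_card_of_nodup nodup_pairs, ← Set.ncard_coe_finset]
  refine Set.ncard_congr (fun M _ => rows M) ?_ ?_ ?_
  · rintro M ⟨h, hr⟩
    simpa using rows_mem M h hr
  · rintro M N ⟨_, hM⟩ ⟨_, hN⟩ he
    rw [← build_rows M hM, ← build_rows N hN, he]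
  · rintro ⟨b, c⟩ h
    have h : (b, c) ∈ pairs := by simpa using h
    obtain ⟨h1, h2⟩ := build_mem b c h
    exact ⟨build b c, h1, h2⟩

end LatinTrap

/-- The number of reduced three-rowed Latin trapezoids with base length 7
is exactly 67295. -/
theorem reduced_latin_trapezoids_base_7 :
    Set.ncard {M : TrapIdx 7 → ℕ |
      IsLatinTrapezoid 7 M ∧ IsReducedLatinTrapezoid 7 M} = 67295 := by
  exact LatinTrap.main_count
end
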